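/- Fix an integer d ≥ 2. Then lim_{Z→∞} of the limsup as x → ∞ of the quantity #{Q ∈ ℤ^{2d+2} : max_i |Q_i| ≤ x and p^{2d} divides 𝔯(Q) for some prime p > Z} / (2x)^{2d+2} equals 0. -/

import Mathlib

open Filter MvPolynomial

noncomputable section

/-- The `2d × 2d` Sylvester matrix of the two generic binary forms of degree `d`,
with entries taken from the coordinates of `Q` (the first `d+1` coordinates of `Q`
are the coefficients of `F`, the last `d+1` ones those of `G`). -/
def sylvesterMat (d : ℕ) {R : Type*} [CommRing R] (Q : Fin (2 * d + 2) → R) :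
    Matrix (Fin (2 * d)) (Fin (2 * d)) R :=
  Matrix.of fun i j =>
    if hi : (i : ℕ) < d then
      if h : (i : ℕ) ≤ (j : ℕ) ∧ (j : ℕ) ≤ (i : ℕ) + d then
        Q ⟨(j : ℕ) - (i : ℕ), by omega⟩
      else 0
    else
      if h : (i : ℕ) - d ≤ (j : ℕ) ∧ (j : ℕ) ≤ (i : ℕ) then
        Q ⟨d + 1 + ((j : ℕ) - ((i : ℕ) - d)), by omega⟩
      else 0

/-- The generic resultant polynomial `𝔯 ∈ ℤ[x₀,…,x_d,y₀,…,y_d]`: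
the determinant of the Sylvester matrix of the generic binary forms of degree `d`. -/
def resPoly (d : ℕ) : MvPolynomial (Fin (2 * d + 2)) ℤ :=
  Matrix.det (sylvesterMat d fun i => X i)

/-- Evaluation `𝔯(Q)` of the generic resultant at a tuple `Q` with entries in a
commutative ring (i.e. evaluation of the image of `𝔯` under the coefficient map `ℤ → R`). -/
def resEval (d : ℕ) {R : Type*} [CommRing R] (Q : Fin (2 * d + 2) → R) : R :=
  aeval Q (resPoly d)

/-- The set `𝒫 ⊆ ℤ^{2d+2}` identified with `ℙ^{2d+1}(ℚ)`: integer tuples with gcd `1`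
whose first nonzero coordinate is positive. -/
def projPts (d : ℕ) : Set (Fin (2 * d + 2) → ℤ) :=
  {C | Finset.univ.gcd C = 1 ∧ ∃ i, 0 < C i ∧ ∀ j, j < i → C j = 0}

/-- The box of integer tuples with `|xᵢ| ≤ rᵢ` for all `i`. -/
def box {m : ℕ} (r : Fin m → ℝ) : Set (Fin m → ℤ) :=
  {x | ∀ i, |(x i : ℝ)| ≤ r i}

/-- The value `ζ(k)` of the Riemann zeta function at an integer `k` (for `k ≥ 2`). -/
def zetaVal (k : ℕ) : ℝ := ∑' n : ℕ+, (1 : ℝ) / ((n : ℕ) : ℝ) ^ k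

/-- The local factor `π_p^{(k)}`. -/
def piLocal (d p k : ℕ) : ℝ :=
  (Nat.card {Q : Fin (2 * d + 2) → ZMod (p ^ k) // resEval d Q ≠ 0} : ℝ) /
    ((p : ℝ) ^ ((2 * d + 2) * k) * (1 - 1 / (p : ℝ) ^ (2 * d + 2)))

theorem resEval_eq_det (d : ℕ) {R : Type*} [CommRing R] (Q : Fin (2 * d + 2) → R) :
    resEval d Q = (sylvesterMat d Q).det := by
  rw [resEval, resPoly, AlgHom.map_det]
  congr 1
  ext i j
  simp only [sylvesterMat, AlgHom.mapMatrix_apply, Matrix.map_apply, Matrix.of_apply]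
  split_ifs <;> simp

theorem map_resEval (d : ℕ) {R S : Type*} [CommRing R] [CommRing S] (φ : R →+* S)
    (Q : Fin (2 * d + 2) → R) : φ (resEval d Q) = resEval d fun i => φ (Q i) := by
  rw [resEval_eq_det, resEval_eq_det, RingHom.map_det]
  congr 1
  ext i j
  simp only [sylvesterMat, RingHom.mapMatrix_apply, Matrix.map_apply, Matrix.of_apply]
  split_ifs <;> simp

/-- The permutation of the columns of the Sylvester matrix exchanging its two halves. -/
def swapHalves (d : ℕ) : Equiv.Perm (Fin (2 * d)) :=
  Function.Involutive.toPerm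
    (fun j => ⟨if (j : ℕ) < d then j + d else j - d, by split_ifs <;> omega⟩) (by
      intro j
      ext
      simp only
      split_ifs <;> omega)

theorem coe_swapHalves (d : ℕ) (j : Fin (2 * d)) :
    (swapHalves d j : ℕ) = if (j : ℕ) < d then j + d else j - d := rfl

/-- The coefficient index of the constant coefficient of the second form. -/
def idxG (d : ℕ) : Fin (2 * d + 2) := ⟨d + 1, by omega⟩

/-- The coefficient index of the leading coefficient of the first form. -/
def idxF (d : ℕ) : Fin (2 * d + 2) := ⟨d, by omega⟩

/-- The resultant is a polynomial of degree at most `d` in the constant coefficient of the second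
form, and its coefficient of degree `d` is, up to sign, the `d`-th power of the leading coefficient
of the first form. -/
theorem exists_polynomial_resEval_update (d : ℕ) {R : Type*} [CommRing R]
    (Q : Fin (2 * d + 2) → R) :
    ∃ P : Polynomial R, P.natDegree ≤ d ∧ (∃ u : ℤˣ, P.coeff d = (u : ℤ) * Q (idxF d) ^ d) ∧
      ∀ t, P.eval t = resEval d (Function.update Q (idxG d) t) := by
  classical
  set Q' : Fin (2 * d + 2) → Polynomial R :=
    Function.update (fun i => Polynomial.C (Q i)) (idxG d) Polynomial.X with hQ'
  set A : Matrix (Fin (2 * d)) (Fin (2 * d)) R := Matrix.of fun i j =>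
    if (j : ℕ) < d then (if (i : ℕ) = j + d then 1 else 0) else sylvesterMat d Q i j with hA
  set B : Matrix (Fin (2 * d)) (Fin (2 * d)) R := Matrix.of fun i j =>
    if (j : ℕ) < d then sylvesterMat d (Function.update Q (idxG d) 0) i j else 0 with hB
  have hscale : Polynomial.X ^ d * resEval d Q' =
      ((Polynomial.X : Polynomial R) • A.map Polynomial.C + B.map Polynomial.C).det := by
    have hprod : ∏ j : Fin (2 * d), (if (j : ℕ) < d then 1 else (Polynomial.X : Polynomial R)) =
        Polynomial.X ^ d := by
      rw [Fin.prod_univ_eq_prod_range (fun j => if j < d then 1 else (Polynomial.X : Polynomial R)),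
        two_mul, Finset.prod_range_add, Finset.prod_congr rfl
          (fun x hx => if_pos (Finset.mem_range.1 hx))]
      simp
    rw [resEval_eq_det, ← hprod, ← Matrix.det_mul_row]
    congr 1
    ext1 i j
    simp only [hA, hB, hQ', sylvesterMat, Matrix.of_apply, Matrix.add_apply, Matrix.smul_apply,
      Matrix.map_apply, Function.update_apply, idxG, Fin.mk.injEq, smul_eq_mul]
    split_ifs <;> first | omega | simp
  have hdetA : ∃ u : ℤˣ, A.det = (u : ℤ) * Q (idxF d) ^ d := by
    have h1 : (A.submatrix id (swapHalves d)).det = Q (idxF d) ^ d := by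
      rw [Matrix.det_of_isLowerTriangular]
      · have : ∀ j : Fin (2 * d), A.submatrix id (swapHalves d) j j =
            (fun k : ℕ => if k < d then Q (idxF d) else 1) j := by
          intro j
          simp only [hA, sylvesterMat, Matrix.submatrix_apply, Matrix.of_apply, id, coe_swapHalves,
            idxF]
          split_ifs <;> first | omega | simp
        rw [Finset.prod_congr rfl (fun j _ => this j),
          Fin.prod_univ_eq_prod_range (fun k => if k < d then Q (idxF d) else 1),
          two_mul, Finset.prod_range_add, Finset.prod_congr rfl
          (fun x hx => if_pos (Finset.mem_range.1 hx))]
        simp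
      · intro i j hij
        have hij' : (i : ℕ) < j := by simpa using hij
        simp only [hA, sylvesterMat, Matrix.submatrix_apply, Matrix.of_apply, id, coe_swapHalves]
        split_ifs <;> first | omega | simp
    rw [Matrix.det_permute'] at h1
    refine ⟨Equiv.Perm.sign (swapHalves d), ?_⟩
    rw [← h1, ← mul_assoc, ← Int.cast_mul, ← Units.val_mul, Int.units_mul_self]
    simp
  have hcoeff : ∀ k, (resEval d Q').coeff k =
      ((Polynomial.X : Polynomial R) • A.map Polynomial.C + B.map Polynomial.C).det.coeff
        (k + d) := by
    intro k
    rw [← hscale, Polynomial.coeff_X_pow_mul]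
  refine ⟨resEval d Q', ?_, ?_, ?_⟩
  · rw [Polynomial.natDegree_le_iff_coeff_eq_zero]
    intro k hk
    rw [hcoeff]
    apply Polynomial.coeff_eq_zero_of_natDegree_lt
    refine (Polynomial.natDegree_det_X_add_C_le A B).trans_lt ?_
    rw [Fintype.card_fin]
    omega
  · obtain ⟨u, hu⟩ := hdetA
    refine ⟨u, ?_⟩
    have := Polynomial.coeff_det_X_add_C_card A B
    rw [Fintype.card_fin] at this
    rw [hcoeff, ← two_mul, this, hu]
  · intro t
    have := map_resEval d (Polynomial.evalRingHom t) Q'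
    rw [Polynomial.coe_evalRingHom] at this
    rw [this]
    congr 1
    ext i
    simp only [hQ', Function.update_apply]
    split_ifs <;> simp

/-- If the leading coefficient of an integer polynomial of degree `d` is prime to `p`, then the
integers at which its values are divisible by `p ^ (2 * d)` lie in at most `d` classes modulo
`p ^ 2`. -/
theorem card_le_of_pow_dvd_eval {p d : ℕ} (hp : p.Prime) (hd : 1 ≤ d) {P : Polynomial ℤ}
    (hP : P.natDegree ≤ d) (hc : ¬ (p : ℤ) ∣ P.coeff d) (s : Finset ℤ)
    (hs : ∀ a ∈ s, ∀ b ∈ s, a ≠ b → ¬ (p : ℤ) ^ 2 ∣ a - b)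
    (hv : ∀ a ∈ s, (p : ℤ) ^ (2 * d) ∣ P.eval a) : s.card ≤ d := by
  by_contra! hcard
  obtain ⟨s', hs's, hs'⟩ := Finset.exists_subset_card_eq (show d + 1 ≤ s.card from hcard)
  have := Fact.mk hp
  have hp1 : (1 : ℝ) < p := by exact_mod_cast hp.one_lt
  have hp0 : (0 : ℝ) < p := by linarith
  apply hc
  have hinj : Set.InjOn (fun a : ℤ => (a : ℚ_[p])) s' := fun a _ b _ h => by simpa using h
  have key := Lagrange.coeff_eq_sum (P := P.map (Int.castRingHom ℚ_[p])) hinj (by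
    refine (Polynomial.degree_map_le).trans_lt ?_
    rw [hs']
    exact (Polynomial.natDegree_le_iff_degree_le.1 hP).trans_lt
      (by exact_mod_cast Nat.lt_succ_self d))
  rw [hs', Nat.add_sub_cancel, Polynomial.coeff_map, eq_intCast] at key
  rw [← Padic.norm_intCast_lt_one_iff, key]
  refine lt_of_le_of_lt (IsUltrametricDist.norm_sum_le_of_forall_le_of_nonneg
    (C := (p : ℝ) ^ (-d : ℤ)) (by positivity) ?_) ?_
  · intro i hi
    have h1 : ‖∏ j ∈ s'.erase i, ((i : ℚ_[p]) - j)‖ ≥ (p : ℝ) ^ (-d : ℤ) := by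
      rw [norm_prod]
      have : (p : ℝ) ^ (-d : ℤ) = ∏ j ∈ s'.erase i, (p : ℝ) ^ (-1 : ℤ) := by
        rw [Finset.prod_const, Finset.card_erase_of_mem hi, hs', Nat.add_sub_cancel, zpow_neg,
          zpow_neg, zpow_one, zpow_natCast, inv_pow]
      rw [this]
      refine Finset.prod_le_prod (fun _ _ => by positivity) fun j hj => ?_
      by_contra! hlt
      rw [show (-1 : ℤ) = -2 + 1 by norm_num, ← Padic.norm_le_pow_iff_norm_lt_pow_add_one,
        ← Int.cast_sub] at hlt
      have := (Padic.norm_int_le_pow_iff_dvd _ 2).1 (by exact_mod_cast hlt)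
      exact hs i (hs's hi) j (hs's (Finset.mem_of_mem_erase hj))
        (Finset.ne_of_mem_erase hj).symm this
    have h2 : ‖(P.map (Int.castRingHom ℚ_[p])).eval (i : ℚ_[p])‖ ≤
        (p : ℝ) ^ (-(2 * d : ℕ) : ℤ) := by
      rw [Polynomial.eval_intCast_map, eq_intCast]
      exact (Padic.norm_int_le_pow_iff_dvd _ _).2 (hv i (hs's hi))
    rw [norm_div, div_le_iff₀ (lt_of_lt_of_le (by positivity) h1)]
    refine h2.trans (le_trans (le_of_eq ?_) (mul_le_mul_of_nonneg_left h1 (by positivity)))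
    rw [← zpow_add₀ hp0.ne']
    congr 1
    push_cast
    ring
  · rw [zpow_neg, zpow_natCast]
    exact inv_lt_one_of_one_lt₀ (one_lt_pow₀ hp1 (by omega))

/-- A residue class modulo `M` contains at most `2 * N / M + 1` integers of `[-N, N]`. -/
theorem card_filter_dvd_sub_le (N : ℕ) {M : ℕ} (hM : 0 < M) (s : Finset ℤ)
    (hs : s ⊆ Finset.Icc (-N : ℤ) N) (h : ∀ a ∈ s, ∀ b ∈ s, (M : ℤ) ∣ a - b) :
    s.card ≤ 2 * N / M + 1 := by
  have hM' : (0 : ℤ) < M := by exact_mod_cast hM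
  have hcard : (Finset.Icc (0 : ℤ) ((2 * N / M : ℕ) : ℤ)).card = 2 * N / M + 1 := by
    rw [Int.card_Icc, sub_zero, ← Nat.cast_succ, Int.toNat_natCast]
  rw [← hcard]
  refine Finset.card_le_card_of_injOn (fun a => (a + N) / M) ?_ ?_
  · intro a ha
    have := Finset.mem_Icc.1 (hs ha)
    simp only [Finset.coe_Icc, Set.mem_Icc]
    refine ⟨Int.ediv_nonneg (by omega) hM'.le, ?_⟩
    push_cast
    exact Int.ediv_le_ediv hM' (by omega)
  · intro a ha b hb hab
    simp only at hab
    have h1 : (a + N) % (M : ℤ) = (b + N) % M :=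
      ((Int.modEq_iff_dvd.2 (h b hb a ha)).add_right N)
    have h2 := Int.mul_ediv_add_emod (a + N) M
    have h3 := Int.mul_ediv_add_emod (b + N) M
    rw [hab, h1] at h2
    omega

/-- The tuples of integers of absolute value at most `N`. -/
def intBox (n N : ℕ) : Finset (Fin n → ℤ) := Fintype.piFinset fun _ => Finset.Icc (-N : ℤ) N

theorem card_Icc_neg_self (N : ℕ) : (Finset.Icc (-N : ℤ) N).card = 2 * N + 1 := by
  rw [Int.card_Icc]; omega

/-- If the leading coefficient of an integer polynomial of degree `d` is prime to `p`, then few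
integers in `[-N, N]` have value divisible by `p ^ (2 * d)`. -/
theorem card_filter_pow_dvd_eval_le {p d : ℕ} (hp : p.Prime) (hd : 1 ≤ d) (N : ℕ)
    {P : Polynomial ℤ} (hP : P.natDegree ≤ d) (hc : ¬ (p : ℤ) ∣ P.coeff d) :
    ((Finset.Icc (-N : ℤ) N).filter fun t => (p : ℤ) ^ (2 * d) ∣ P.eval t).card ≤
      (2 * N / p ^ 2 + 1) * d := by
  set s := (Finset.Icc (-N : ℤ) N).filter fun t => (p : ℤ) ^ (2 * d) ∣ P.eval t with hs
  have hpp : 0 < p ^ 2 := pow_pos hp.pos 2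
  obtain ⟨u, hus, hinj, hfu⟩ := Finset.exists_subset_injOn_image_eq_of_surjOn
    (f := fun t : ℤ => (t : ZMod (p ^ 2))) (s := s) (s.image fun t : ℤ => (t : ZMod (p ^ 2)))
    (by rw [Finset.coe_image]; exact Set.surjOn_image _ _)
  refine (Finset.card_le_mul_card_image (f := fun t : ℤ => (t : ZMod (p ^ 2))) s _ ?_).trans
    (Nat.mul_le_mul_left _ ?_)
  · intro b _
    refine card_filter_dvd_sub_le N hpp _ ((Finset.filter_subset _ _).trans
      (Finset.filter_subset _ _)) ?_
    intro a ha a' ha'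
    exact (ZMod.intCast_eq_intCast_iff_dvd_sub _ _ _).1
      ((Finset.mem_filter.1 ha').2.trans (Finset.mem_filter.1 ha).2.symm)
  · refine (congrArg Finset.card hfu).symm.trans_le ?_
    rw [Finset.card_image_of_injOn hinj]
    refine card_le_of_pow_dvd_eval hp hd hP hc u ?_ ?_
    · intro a ha b hb hab hdvd
      refine hab (hinj ha hb ?_)
      refine ((ZMod.intCast_eq_intCast_iff_dvd_sub b a (p ^ 2)).2 ?_).symm
      exact_mod_cast hdvd
    · exact fun a ha => (Finset.mem_filter.1 (hus ha)).2

/-- Few tuples in a box have leading coefficient prime to `p` and resultant divisible by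
`p ^ (2 * d)`. -/
theorem card_filter_not_dvd_le {p d : ℕ} (hp : p.Prime) (hd : 1 ≤ d) (N : ℕ) :
    ((intBox (2 * d + 2) N).filter fun Q =>
      ¬ (p : ℤ) ∣ Q (idxF d) ∧ (p : ℤ) ^ (2 * d) ∣ resEval d Q).card ≤
      (2 * N / p ^ 2 + 1) * d * (2 * N + 1) ^ (2 * d + 1) := by
  classical
  have hne : idxF d ≠ idxG d := by simp [idxF, idxG]
  set T : Finset (Fin (2 * d + 2) → ℤ) := Fintype.piFinset
    fun i => if i = idxG d then {0} else Finset.Icc (-N : ℤ) N with hT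
  have hTcard : T.card = (2 * N + 1) ^ (2 * d + 1) := by
    rw [hT, Fintype.card_piFinset, ← Finset.mul_prod_erase _ _ (Finset.mem_univ (idxG d)),
      if_pos rfl, Finset.card_singleton, one_mul, Finset.prod_congr rfl (fun i hi => by
        rw [if_neg (Finset.ne_of_mem_erase hi), card_Icc_neg_self]), Finset.prod_const,
      Finset.card_erase_of_mem (Finset.mem_univ _), Finset.card_univ, Fintype.card_fin]
    rfl
  rw [← hTcard]
  refine Finset.card_le_mul_card_image_of_maps_to (f := fun Q => Function.update Q (idxG d) 0)
    ?_ _ ?_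
  · intro Q hQ
    rw [Finset.mem_filter, intBox, Fintype.mem_piFinset] at hQ
    rw [hT, Fintype.mem_piFinset]
    intro i
    by_cases hi : i = idxG d
    · subst hi; simp
    · simpa [hi] using hQ.1 i
  · intro R _
    obtain ⟨P, hdeg, ⟨u, hu⟩, hev⟩ := exists_polynomial_resEval_update d R
    by_cases hR : (p : ℤ) ∣ R (idxF d)
    · rw [Finset.card_eq_zero.2]
      · exact Nat.zero_le _
      · refine Finset.filter_eq_empty_iff.2 fun Q hQ hQR => ?_
        refine (Finset.mem_filter.1 hQ).2.1 ?_
        rwa [← hQR, Function.update_of_ne hne] at hR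
    refine le_trans ?_ (card_filter_pow_dvd_eval_le hp hd N hdeg ?_)
    · refine Finset.card_le_card_of_injOn (fun Q => Q (idxG d)) ?_ ?_
      · intro Q hQ
        obtain ⟨hQ, hQR⟩ := Finset.mem_filter.1 hQ
        obtain ⟨hQ, -, hdvd⟩ := Finset.mem_filter.1 hQ
        simp only [Finset.coe_filter, Set.mem_ofPred_eq]
        refine ⟨Fintype.mem_piFinset.1 hQ _, ?_⟩
        rwa [hev, ← hQR, Function.update_idem, Function.update_eq_self]
      · intro Q hQ Q' hQ' h
        have h1 := (Finset.mem_filter.1 hQ).2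
        have h2 := (Finset.mem_filter.1 hQ').2
        rw [← Function.update_eq_self (idxG d) Q, ← Function.update_eq_self (idxG d) Q',
          ← Function.update_idem (a := idxG d) (0 : ℤ) (Q (idxG d)) Q,
          ← Function.update_idem (a := idxG d) (0 : ℤ) (Q' (idxG d)) Q', h1, h2]
        exact congrArg _ h
    · rw [hu]
      intro h
      apply hR
      rw [Int.cast_id, IsUnit.dvd_mul_left u.isUnit] at h
      exact Int.Prime.dvd_pow' hp h

/-- The pair of forms `(Y ^ d, X ^ d)` has resultant `1`. -/
theorem resEval_coprime_powers (d : ℕ) (R : Type*) [CommRing R] :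
    resEval d (fun i : Fin (2 * d + 2) =>
      if (i : ℕ) = 0 ∨ (i : ℕ) = 2 * d + 1 then (1 : R) else 0) = 1 := by
  rw [resEval_eq_det]
  refine Eq.trans (congrArg Matrix.det ?_) (Matrix.det_one (n := Fin (2 * d)))
  ext i j
  rw [Matrix.one_apply]
  simp only [sylvesterMat, Matrix.of_apply, Fin.ext_iff]
  split_ifs <;> first | rfl | omega

theorem eval_map_resPoly (d : ℕ) {R : Type*} [CommRing R] (Q : Fin (2 * d + 2) → R) :
    eval Q (MvPolynomial.map (Int.castRingHom R) (resPoly d)) = resEval d Q := by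
  rw [resEval, eval_map, aeval_def]
  congr 1

/-- The integer tuples in a box at which the resultant vanishes are sparse. -/
theorem exists_card_filter_resEval_eq_zero_le (d : ℕ) :
    ∃ C : ℕ, ∀ N : ℕ, ((intBox (2 * d + 2) N).filter fun Q => resEval d Q = 0).card ≤
      C * (2 * N + 1) ^ (2 * d + 1) := by
  have hne : resPoly d ≠ 0 := by
    intro h
    have := resEval_coprime_powers d ℤ
    rw [resEval, h] at this
    simp at this
  refine ⟨(resPoly d).totalDegree, fun N => ?_⟩
  have := schwartz_zippel_totalDegree hne (Finset.Icc (-N : ℤ) N)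
  rw [card_Icc_neg_self, div_le_div_iff₀ (by positivity) (by positivity), pow_succ,
    ← mul_assoc] at this
  have := le_of_mul_le_mul_right this (by positivity)
  have h2 : ∀ Q : Fin (2 * d + 2) → ℤ, eval Q (resPoly d) = resEval d Q := by
    intro Q
    rw [← eval_map_resPoly, eval_map]
    rfl
  simp only [h2] at this
  exact_mod_cast this

/-- The tuples modulo `p` with zero coordinate `idxF d` and vanishing resultant are few. -/
theorem exists_card_filter_zmod_le {d : ℕ} (hd : 1 ≤ d) :
    ∃ C : ℕ, ∀ p : ℕ, [Fact p.Prime] →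
      (((Fintype.piFinset fun i => if i = idxF d then {0} else Finset.univ :
        Finset (Fin (2 * d + 2) → ZMod p))).filter fun Q => resEval d Q = 0).card ≤
        C * p ^ (2 * d) := by
  classical
  set f : Fin (2 * d + 2) → MvPolynomial (Fin (2 * d + 2)) ℤ :=
    fun i => if i = idxF d then 0 else X i with hf
  set g : MvPolynomial (Fin (2 * d + 2)) ℤ := bind₁ f (resPoly d) with hg
  have hvars : idxF d ∉ g.vars := by
    intro h
    have := vars_bind₁ f (resPoly d) h
    rw [Finset.mem_biUnion] at this
    obtain ⟨i, -, hi⟩ := this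
    simp only [hf] at hi
    split_ifs at hi with h
    · simp at hi
    · rw [vars_X, Finset.mem_singleton] at hi
      exact h hi.symm
  refine ⟨∑ i, g.degreeOf i, fun p hp => ?_⟩
  have hev : ∀ Q : Fin (2 * d + 2) → ZMod p,
      eval Q (MvPolynomial.map (Int.castRingHom (ZMod p)) g) =
        resEval d fun i => if i = idxF d then 0 else Q i := by
    intro Q
    rw [eval_map, hg, ← coe_eval₂Hom, eval₂Hom_bind₁, ← eval_map_resPoly, eval_map, coe_eval₂Hom]
    congr 1
    ext i
    simp only [hf]
    split_ifs <;> simp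
  have hne : MvPolynomial.map (Int.castRingHom (ZMod p)) g ≠ 0 := by
    intro h
    have h1 := hev (fun i => if (i : ℕ) = 0 ∨ (i : ℕ) = 2 * d + 1 then 1 else 0)
    rw [h, map_zero] at h1
    refine zero_ne_one (h1.trans (Eq.trans ?_ (resEval_coprime_powers d (ZMod p))))
    congr 1
    ext i
    by_cases hi : i = idxF d
    · rw [if_pos hi, if_neg]
      simp only [hi, idxF]
      omega
    · rw [if_neg hi]
  have hdeg : ∀ i, (MvPolynomial.map (Int.castRingHom (ZMod p)) g).degreeOf i ≤ g.degreeOf i := by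
    intro i
    rw [degreeOf_def, degreeOf_def]
    exact Multiset.count_le_of_le _ degrees_map_le
  have hdegF : g.degreeOf (idxF d) = 0 := by
    rwa [mem_vars_iff_degreeOf_ne_zero, not_not] at hvars
  have hp0 : (0 : ℚ≥0) < p := by exact_mod_cast hp.out.pos
  set S : Fin (2 * d + 2) → Finset (ZMod p) :=
    fun i => if i = idxF d then {0} else Finset.univ with hS
  have hprod : ∏ i, ((S i).card : ℚ≥0) = p ^ (2 * d) * p := by
    rw [← Finset.mul_prod_erase _ _ (Finset.mem_univ (idxF d)), Finset.prod_congr rfl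
      (fun i hi => by
        rw [show S i = Finset.univ from if_neg (Finset.ne_of_mem_erase hi), Finset.card_univ,
          ZMod.card]), Finset.prod_const,
      Finset.card_erase_of_mem (Finset.mem_univ _), Finset.card_univ, Fintype.card_fin]
    simp [hS, pow_succ]
  have hsum : ∑ i, ((MvPolynomial.map (Int.castRingHom (ZMod p)) g).degreeOf i / (S i).card : ℚ≥0)
      ≤ (∑ i, g.degreeOf i : ℕ) / p := by
    rw [Nat.cast_sum, Finset.sum_div]
    refine Finset.sum_le_sum fun i _ => ?_
    by_cases hi : i = idxF d
    · have := hdeg i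
      rw [hi, hdegF, Nat.le_zero] at this
      rw [hi, this, hdegF]
      simp
    · simp only [hS]
      rw [if_neg hi, Finset.card_univ, ZMod.card]
      gcongr
      exact hdeg i
  have key := (schwartz_zippel_sum_degreeOf hne S).trans hsum
  rw [hprod, div_le_div_iff₀ (by positivity) hp0, ← mul_assoc] at key
  have key2 := le_of_mul_le_mul_right key hp0
  have hfil : ((Fintype.piFinset S).filter fun Q => resEval d Q = 0) =
      (Fintype.piFinset S).filter fun Q =>
        eval Q (MvPolynomial.map (Int.castRingHom (ZMod p)) g) = 0 := by
    refine Finset.filter_congr fun Q hQ => ?_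
    rw [hev]
    have : (fun i => if i = idxF d then 0 else Q i) = Q := by
      ext i
      by_cases hi : i = idxF d
      · have := Fintype.mem_piFinset.1 hQ i
        simp only [hS, if_pos hi, Finset.mem_singleton] at this
        rw [if_pos hi, this]
      · rw [if_neg hi]
    rw [this]
  rw [hfil]
  exact_mod_cast key2

/-- Integer tuples in a box whose leading coefficient and resultant are divisible by `p` are
few. -/
theorem exists_card_filter_dvd_le {d : ℕ} (hd : 1 ≤ d) :
    ∃ C : ℕ, ∀ p N : ℕ, p.Prime → ((intBox (2 * d + 2) N).filter fun Q =>
      (p : ℤ) ∣ Q (idxF d) ∧ (p : ℤ) ∣ resEval d Q).card ≤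
        (2 * N / p + 1) ^ (2 * d + 2) * (C * p ^ (2 * d)) := by
  classical
  obtain ⟨C, hC⟩ := exists_card_filter_zmod_le hd
  refine ⟨C, fun p N hp => ?_⟩
  have : Fact p.Prime := ⟨hp⟩
  refine le_trans (Finset.card_le_mul_card_image_of_maps_to
    (f := fun (Q : Fin (2 * d + 2) → ℤ) i => (Q i : ZMod p)) ?_ _ ?_)
    (Nat.mul_le_mul_left _ (hC p))
  · intro Q hQ
    obtain ⟨-, h1, h2⟩ := Finset.mem_filter.1 hQ
    refine Finset.mem_filter.2 ⟨Fintype.mem_piFinset.2 fun i => ?_, ?_⟩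
    · by_cases hi : i = idxF d
      · rw [if_pos hi, Finset.mem_singleton, hi]
        exact (ZMod.intCast_zmod_eq_zero_iff_dvd _ _).2 h1
      · rw [if_neg hi]
        exact Finset.mem_univ _
    · have := map_resEval d (Int.castRingHom (ZMod p)) Q
      simp only [eq_intCast] at this
      rw [← this]
      exact (ZMod.intCast_zmod_eq_zero_iff_dvd _ _).2 h2
  · intro b _
    set s : Fin (2 * d + 2) → Finset ℤ :=
      fun i => (Finset.Icc (-N : ℤ) N).filter fun t => (t : ZMod p) = b i with hs
    have hsub : Finset.filter (fun Q : Fin (2 * d + 2) → ℤ => (fun i => (Q i : ZMod p)) = b)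
        ((intBox (2 * d + 2) N).filter fun Q => (p : ℤ) ∣ Q (idxF d) ∧ (p : ℤ) ∣ resEval d Q) ⊆
        Fintype.piFinset s := by
      intro Q hQ
      obtain ⟨hQ, hb⟩ := Finset.mem_filter.1 hQ
      refine Fintype.mem_piFinset.2 fun i => Finset.mem_filter.2
        ⟨Fintype.mem_piFinset.1 (Finset.mem_filter.1 hQ).1 i, congrFun hb i⟩
    refine (Finset.card_le_card hsub).trans ?_
    rw [Fintype.card_piFinset]
    refine (Finset.prod_le_pow_card _ _ _ fun i _ => card_filter_dvd_sub_le N hp.pos (s i)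
      (Finset.filter_subset _ _) ?_).trans_eq (by rw [Finset.card_univ, Fintype.card_fin])
    intro a ha a' ha'
    exact (ZMod.intCast_eq_intCast_iff_dvd_sub _ _ _).1
      ((Finset.mem_filter.1 ha').2.trans (Finset.mem_filter.1 ha).2.symm)

/-- The primes whose `2 * d`-th power divides a nonzero resultant are bounded linearly in the size
of the coefficients. -/
theorem le_of_pow_dvd_resEval {d p N : ℕ} (hd : 1 ≤ d) {Q : Fin (2 * d + 2) → ℤ}
    (hQ : Q ∈ intBox (2 * d + 2) N) (h0 : resEval d Q ≠ 0)
    (hdvd : (p : ℤ) ^ (2 * d) ∣ resEval d Q) : p ≤ (2 * d).factorial * N := by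
  have h1 : |resEval d Q| ≤ ((2 * d).factorial : ℤ) * (N : ℤ) ^ (2 * d) := by
    have := Matrix.det_le (A := sylvesterMat d Q) (abv := AbsoluteValue.abs) (x := (N : ℤ)) (by
      have hQ' : ∀ i, |Q i| ≤ N := fun i =>
        abs_le.2 (Finset.mem_Icc.1 (Fintype.mem_piFinset.1 hQ i))
      intro i j
      simp only [sylvesterMat, Matrix.of_apply, AbsoluteValue.abs_apply]
      split_ifs <;> first | exact hQ' _ | simp)
    rwa [← resEval_eq_det, Fintype.card_fin, nsmul_eq_mul] at this
  have h2 : (p : ℤ) ^ (2 * d) ≤ |resEval d Q| :=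
    Int.le_of_dvd (abs_pos.2 h0) ((dvd_abs _ _).2 hdvd)
  have h3 : p ^ (2 * d) ≤ (2 * d).factorial * N ^ (2 * d) := by exact_mod_cast h2.trans h1
  refine le_of_not_gt fun hlt => ?_
  have h4 : ((2 * d).factorial * N) ^ (2 * d) < p ^ (2 * d) :=
    Nat.pow_lt_pow_left hlt (by omega)
  rw [mul_pow] at h4
  have h5 : (2 * d).factorial ≤ (2 * d).factorial ^ (2 * d) := Nat.le_self_pow (by omega) _
  have := Nat.mul_le_mul_right (N ^ (2 * d)) h5
  omega

open scoped Classical in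
/-- The integer tuples in a box whose resultant is divisible by `p ^ (2 * d)` for some prime
`p > Z`. -/
theorem exists_card_filter_exists_prime_le {d : ℕ} (hd : 1 ≤ d) :
    ∃ C : ℝ, ∃ K : ℕ, 0 ≤ C ∧ 0 < K ∧ ∀ (N : ℕ) (Z : ℝ), 1 ≤ N → 0 < Z →
      (((intBox (2 * d + 2) N).filter fun Q => ∃ p : ℕ, p.Prime ∧ Z < (p : ℝ) ∧
        (p : ℤ) ^ (2 * d) ∣ resEval d Q).card : ℝ) ≤
      C * (N : ℝ) ^ (2 * d + 2) *
        (1 / N + 1 / Z + (Nat.primeCounting (K * N) : ℝ) / N) := by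
  classical
  obtain ⟨C₀, h₀⟩ := exists_card_filter_resEval_eq_zero_le d
  obtain ⟨C₁, h₁⟩ := exists_card_filter_dvd_le hd
  set K := (2 * d).factorial with hK
  set n := 2 * d + 1 with hn
  set c₀ : ℝ := C₀ * 3 ^ n with hc₀
  set c₁ : ℝ := (2 + K) ^ (n + 1) * C₁ with hc₁
  set c₂ : ℝ := d * 3 ^ n with hc₂
  have hc₀' : 0 ≤ c₀ := by positivity
  have hc₁' : 0 ≤ c₁ := by positivity
  have hc₂' : 0 ≤ c₂ := by positivity
  refine ⟨c₀ + 2 * (c₁ + 2 * c₂) + c₂, K, by positivity, Nat.factorial_pos _,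
    fun N Z hN hZ => ?_⟩
  have hN' : (1 : ℝ) ≤ N := by exact_mod_cast hN
  have hN0 : (0 : ℝ) < N := by linarith
  have h3 : ((2 * N + 1 : ℕ) : ℝ) ^ n ≤ 3 ^ n * (N : ℝ) ^ n := by
    rw [← mul_pow]
    gcongr
    push_cast
    linarith
  set primes : Finset ℕ := (Finset.Ioo ⌊Z⌋₊ (K * N + 1)).filter Nat.Prime with hprimes
  set box₀ := (intBox (2 * d + 2) N).filter fun Q => resEval d Q = 0 with hbox₀
  set boxA : ℕ → Finset (Fin (2 * d + 2) → ℤ) := fun p => (intBox (2 * d + 2) N).filter fun Q =>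
      (p : ℤ) ∣ Q (idxF d) ∧ (p : ℤ) ∣ resEval d Q with hboxA
  set boxB : ℕ → Finset (Fin (2 * d + 2) → ℤ) := fun p => (intBox (2 * d + 2) N).filter fun Q =>
      ¬ (p : ℤ) ∣ Q (idxF d) ∧ (p : ℤ) ^ (2 * d) ∣ resEval d Q with hboxB
  have hsub : ((intBox (2 * d + 2) N).filter fun Q => ∃ p : ℕ, p.Prime ∧ Z < (p : ℝ) ∧
        (p : ℤ) ^ (2 * d) ∣ resEval d Q) ⊆ box₀ ∪ primes.biUnion fun p => boxA p ∪ boxB p := by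
    intro Q hQ
    obtain ⟨hQ, p, hp, hZp, hdvd⟩ := Finset.mem_filter.1 hQ
    by_cases h0 : resEval d Q = 0
    · exact Finset.mem_union_left _ (Finset.mem_filter.2 ⟨hQ, h0⟩)
    · refine Finset.mem_union_right _ (Finset.mem_biUnion.2 ⟨p, ?_, ?_⟩)
      · refine Finset.mem_filter.2 ⟨Finset.mem_Ioo.2 ⟨(Nat.floor_lt hZ.le).2 hZp, ?_⟩, hp⟩
        exact Nat.lt_succ_of_le (le_of_pow_dvd_resEval hd hQ h0 hdvd)
      · by_cases hF : (p : ℤ) ∣ Q (idxF d)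
        · exact Finset.mem_union_left _ (Finset.mem_filter.2
            ⟨hQ, hF, (dvd_pow_self _ (by omega)).trans hdvd⟩)
        · exact Finset.mem_union_right _ (Finset.mem_filter.2 ⟨hQ, hF, hdvd⟩)
  have hA : ∀ p ∈ primes, ((boxA p).card : ℝ) ≤ c₁ * (N : ℝ) ^ (n + 1) * ((p : ℝ) ^ 2)⁻¹ := by
    intro p hp
    obtain ⟨hp, hpp⟩ := Finset.mem_filter.1 hp
    have hp0 : (0 : ℝ) < p := by exact_mod_cast hpp.pos
    have hpK : (p : ℝ) ≤ K * N := by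
      exact_mod_cast Nat.le_of_lt_succ (Finset.mem_Ioo.1 hp).2
    have hw : ((2 * N / p + 1 : ℕ) : ℝ) ≤ (2 + K) * N / p := by
      have h1 : ((2 * N / p : ℕ) : ℝ) ≤ (2 * N : ℕ) / p := Nat.cast_div_le
      have h2 : (1 : ℝ) ≤ K * N / p := (one_le_div hp0).2 hpK
      push_cast at h1 ⊢
      calc ((2 * N / p : ℕ) : ℝ) + 1 ≤ 2 * N / p + K * N / p := by linarith
        _ = (2 + K) * N / p := by ring
    calc ((boxA p).card : ℝ) ≤ ((2 * N / p + 1 : ℕ) : ℝ) ^ (n + 1) * (C₁ * (p : ℝ) ^ (2 * d)) := by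
          exact_mod_cast h₁ p N hpp
      _ ≤ ((2 + K) * N / p) ^ (n + 1) * (C₁ * (p : ℝ) ^ (2 * d)) := by gcongr
      _ = c₁ * (N : ℝ) ^ (n + 1) * ((p : ℝ) ^ 2)⁻¹ := by
          rw [hc₁, div_pow, mul_pow, show n + 1 = 2 * d + 2 by omega, pow_add (p : ℝ)]
          field_simp
  have hB : ∀ p ∈ primes, ((boxB p).card : ℝ) ≤
      2 * c₂ * (N : ℝ) ^ (n + 1) * ((p : ℝ) ^ 2)⁻¹ + c₂ * (N : ℝ) ^ n := by
    intro p hp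
    obtain ⟨hp, hpp⟩ := Finset.mem_filter.1 hp
    have hw : ((2 * N / p ^ 2 + 1 : ℕ) : ℝ) ≤ 2 * N * ((p : ℝ) ^ 2)⁻¹ + 1 := by
      have h1 : ((2 * N / p ^ 2 : ℕ) : ℝ) ≤ (2 * N : ℕ) / (p ^ 2 : ℕ) := Nat.cast_div_le
      push_cast at h1 ⊢
      rw [← div_eq_mul_inv]
      linarith
    calc ((boxB p).card : ℝ)
        ≤ ((2 * N / p ^ 2 + 1 : ℕ) : ℝ) * d * ((2 * N + 1 : ℕ) : ℝ) ^ n := by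
          exact_mod_cast card_filter_not_dvd_le hpp hd N
      _ ≤ (2 * N * ((p : ℝ) ^ 2)⁻¹ + 1) * d * (3 ^ n * (N : ℝ) ^ n) := by gcongr
      _ = 2 * c₂ * (N : ℝ) ^ (n + 1) * ((p : ℝ) ^ 2)⁻¹ + c₂ * (N : ℝ) ^ n := by
          rw [hc₂]
          ring
  have hsq : ∑ p ∈ primes, ((p : ℝ) ^ 2)⁻¹ ≤ 2 / Z := by
    refine (Finset.sum_le_sum_of_subset_of_nonneg (Finset.filter_subset _ _)
      fun _ _ _ => by positivity).trans ((sum_Ioo_inv_sq_le _ _).trans ?_)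
    gcongr
    exact (Nat.lt_floor_add_one Z).le
  have hcount : (primes.card : ℝ) ≤ Nat.primeCounting (K * N) := by
    rw [Nat.primeCounting, Nat.primeCounting', Nat.count_eq_card_filter_range]
    refine Nat.cast_le.2 (Finset.card_le_card fun p hp => ?_)
    obtain ⟨hp, hpp⟩ := Finset.mem_filter.1 hp
    exact Finset.mem_filter.2 ⟨Finset.mem_range.2 (Finset.mem_Ioo.1 hp).2, hpp⟩
  have hbox₀card : (box₀.card : ℝ) ≤ c₀ * (N : ℝ) ^ n := by
    calc (box₀.card : ℝ) ≤ C₀ * ((2 * N + 1 : ℕ) : ℝ) ^ n := by exact_mod_cast h₀ N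
      _ ≤ C₀ * (3 ^ n * (N : ℝ) ^ n) := by gcongr
      _ = c₀ * (N : ℝ) ^ n := by rw [hc₀]; ring
  have hunion : ((primes.biUnion fun p => boxA p ∪ boxB p).card : ℝ) ≤
      (c₁ + 2 * c₂) * (N : ℝ) ^ (n + 1) * (2 / Z) +
        Nat.primeCounting (K * N) * (c₂ * (N : ℝ) ^ n) := by
    calc ((primes.biUnion fun p => boxA p ∪ boxB p).card : ℝ)
        ≤ ∑ p ∈ primes, (((boxA p).card : ℝ) + (boxB p).card) := by
          exact_mod_cast Finset.card_biUnion_le.trans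
            (Finset.sum_le_sum fun p _ => Finset.card_union_le _ _)
      _ ≤ ∑ p ∈ primes, ((c₁ + 2 * c₂) * (N : ℝ) ^ (n + 1) * ((p : ℝ) ^ 2)⁻¹ +
            c₂ * (N : ℝ) ^ n) := by
          refine Finset.sum_le_sum fun p hp => ?_
          linarith [hA p hp, hB p hp]
      _ = (c₁ + 2 * c₂) * (N : ℝ) ^ (n + 1) * ∑ p ∈ primes, ((p : ℝ) ^ 2)⁻¹ +
            primes.card * (c₂ * (N : ℝ) ^ n) := by
          rw [Finset.sum_add_distrib, ← Finset.mul_sum, Finset.sum_const, nsmul_eq_mul]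
      _ ≤ _ := by gcongr
  set π : ℝ := (Nat.primeCounting (K * N) : ℝ) with hπ
  have hπ0 : 0 ≤ π := by positivity
  have htotal : (((intBox (2 * d + 2) N).filter fun Q => ∃ p : ℕ, p.Prime ∧ Z < (p : ℝ) ∧
        (p : ℤ) ^ (2 * d) ∣ resEval d Q).card : ℝ) ≤ c₀ * (N : ℝ) ^ n +
        ((c₁ + 2 * c₂) * (N : ℝ) ^ (n + 1) * (2 / Z) + π * (c₂ * (N : ℝ) ^ n)) := by
    refine le_trans ?_ (add_le_add hbox₀card hunion)
    exact_mod_cast (Finset.card_le_card hsub).trans (Finset.card_union_le _ _)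
  refine htotal.trans ?_
  have e1 : c₀ * (N : ℝ) ^ n = c₀ * (N : ℝ) ^ (n + 1) * (1 / N) := by
    field_simp
    ring
  have e2 : π * (c₂ * (N : ℝ) ^ n) = c₂ * (N : ℝ) ^ (n + 1) * (π / N) := by
    field_simp
    ring
  have e3 : (c₁ + 2 * c₂) * (N : ℝ) ^ (n + 1) * (2 / Z) =
      2 * (c₁ + 2 * c₂) * (N : ℝ) ^ (n + 1) * (1 / Z) := by ring
  rw [e1, e2, e3, show 2 * d + 2 = n + 1 by omega]
  have p1 : 0 ≤ (N : ℝ) ^ (n + 1) * (1 / N) := by positivity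
  have p2 : 0 ≤ (N : ℝ) ^ (n + 1) * (1 / Z) := by positivity
  have p3 : 0 ≤ (N : ℝ) ^ (n + 1) * (π / N) := by positivity
  have q1 := mul_nonneg (add_nonneg (mul_nonneg zero_le_two (by positivity : 0 ≤ c₁ + 2 * c₂)) hc₂')
    p1
  have q2 := mul_nonneg (add_nonneg hc₀' hc₂') p2
  have q3 := mul_nonneg (add_nonneg hc₀' (mul_nonneg zero_le_two
    (by positivity : 0 ≤ c₁ + 2 * c₂))) p3
  linarith

/-- The primes have density zero, along multiples of `K`. -/
theorem tendsto_primeCounting_mul_div {K : ℕ} (hK : 0 < K) :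
    Tendsto (fun N : ℕ => (Nat.primeCounting (K * N) : ℝ) / N) atTop (nhds 0) := by
  have hK' : (0 : ℝ) < K := by exact_mod_cast hK
  have hlin : Tendsto (fun N : ℕ => (K : ℝ) * N) atTop atTop :=
    tendsto_natCast_atTop_atTop.const_mul_atTop hK'
  have hlog : Tendsto (fun N : ℕ => (Real.log 4 + 1) * K / Real.log (K * N)) atTop (nhds 0) :=
    (Real.tendsto_log_atTop.comp hlin).const_div_atTop _
  refine squeeze_zero' (Eventually.of_forall fun N => by positivity) ?_ hlog
  filter_upwards [hlin.eventually (Chebyshev.eventually_primeCounting_le one_pos),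
    eventually_gt_atTop 0] with N hN hN0
  have hN0' : (0 : ℝ) < N := by exact_mod_cast hN0
  rw [← Nat.cast_mul, Nat.floor_natCast] at hN
  rw [div_le_iff₀ hN0']
  refine hN.trans_eq ?_
  push_cast
  ring

/-- tuples in `[-x,x]^{2d+2}` whose resultant value is divisible by `p^{2d}`
for some prime `p > Z` have density (as `x → ∞`) tending to `0` as `Z → ∞`. -/
theorem stmt_10 (d : ℕ) (hd : 2 ≤ d) :
    Tendsto (fun Z : ℝ =>
        limsup (fun x : ℝ =>
          (Nat.card {Q : Fin (2 * d + 2) → ℤ //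
              (∀ i, |(Q i : ℝ)| ≤ x) ∧
              ∃ p : ℕ, p.Prime ∧ Z < (p : ℝ) ∧ (p : ℤ) ^ (2 * d) ∣ resEval d Q} : ℝ) /
            (2 * x) ^ (2 * d + 2)) atTop)
      atTop (nhds 0) := by
  obtain ⟨C, K, hC, hK, hbound⟩ := exists_card_filter_exists_prime_le (d := d) (by omega)
  set u : ℝ → ℝ → ℝ := fun Z x =>
    (Nat.card {Q : Fin (2 * d + 2) → ℤ //
      (∀ i, |(Q i : ℝ)| ≤ x) ∧
      ∃ p : ℕ, p.Prime ∧ Z < (p : ℝ) ∧ (p : ℤ) ^ (2 * d) ∣ resEval d Q} : ℝ) /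
        (2 * x) ^ (2 * d + 2) with hu
  set v : ℝ → ℝ → ℝ := fun Z x =>
    C * (1 / (⌊x⌋₊ : ℝ) + 1 / Z + (Nat.primeCounting (K * ⌊x⌋₊) : ℝ) / (⌊x⌋₊ : ℝ)) with hv
  have hnonneg : ∀ Z, ∀ᶠ x in atTop, 0 ≤ u Z x := fun Z => by
    filter_upwards [eventually_ge_atTop 0] with x hx
    positivity
  have huv : ∀ Z, 0 < Z → ∀ᶠ x in atTop, u Z x ≤ v Z x := fun Z hZ => by
    filter_upwards [eventually_ge_atTop 1] with x hx
    have hx0 : 0 ≤ x := by linarith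
    have hN : 1 ≤ ⌊x⌋₊ := Nat.le_floor (by exact_mod_cast hx)
    have hcard : (Nat.card {Q : Fin (2 * d + 2) → ℤ //
        (∀ i, |(Q i : ℝ)| ≤ x) ∧
        ∃ p : ℕ, p.Prime ∧ Z < (p : ℝ) ∧ (p : ℤ) ^ (2 * d) ∣ resEval d Q} : ℝ) ≤
        C * (⌊x⌋₊ : ℝ) ^ (2 * d + 2) * (1 / (⌊x⌋₊ : ℝ) + 1 / Z +
          (Nat.primeCounting (K * ⌊x⌋₊) : ℝ) / (⌊x⌋₊ : ℝ)) := by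
      classical
      refine le_trans (Nat.cast_le.2 ?_) (hbound ⌊x⌋₊ Z hN hZ)
      rw [← Nat.card_eq_finsetCard]
      refine Nat.card_le_card_of_injective (fun Q => ⟨Q.1, ?_⟩) fun Q Q' h => ?_
      · refine Finset.mem_filter.2 ⟨Fintype.mem_piFinset.2 fun i => Finset.mem_Icc.2 ?_, Q.2.2⟩
        have h1 : (Q.1 i).natAbs ≤ ⌊x⌋₊ := by
          refine Nat.le_floor ?_
          rw [Nat.cast_natAbs, Int.cast_abs]
          exact Q.2.1 i
        omega
      · exact Subtype.ext (Subtype.mk.inj h)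
    have hfloor : (⌊x⌋₊ : ℝ) ^ (2 * d + 2) ≤ (2 * x) ^ (2 * d + 2) := by
      gcongr
      linarith [Nat.floor_le hx0]
    rw [hu, hv]
    simp only
    rw [div_le_iff₀ (by positivity)]
    refine hcard.trans ?_
    rw [mul_right_comm]
    gcongr
  have hlim : ∀ Z, Tendsto (v Z) atTop (nhds (C * (0 + 1 / Z + 0))) := fun Z => by
    have hfl : Tendsto (fun x : ℝ => ⌊x⌋₊) atTop atTop := tendsto_nat_floor_atTop
    have h1 : Tendsto (fun N : ℕ => 1 / (N : ℝ)) atTop (nhds 0) :=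
      tendsto_one_div_atTop_nhds_zero_nat
    exact (((h1.comp hfl).add tendsto_const_nhds).add
      ((tendsto_primeCounting_mul_div hK).comp hfl)).const_mul C
  have hle : ∀ Z, 0 < Z → limsup (u Z) atTop ≤ C * (0 + 1 / Z + 0) := fun Z hZ => by
    rw [← (hlim Z).limsup_eq]
    exact limsup_le_limsup (huv Z hZ)
      (IsBoundedUnder.isCoboundedUnder_le ⟨0, eventually_map.2 (hnonneg Z)⟩)
      (hlim Z).isBoundedUnder_le
  have hge : ∀ Z, 0 < Z → 0 ≤ limsup (u Z) atTop := fun Z hZ => by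
    refine le_limsup_of_frequently_le (hnonneg Z).frequently ?_
    exact (hlim Z).isBoundedUnder_le.mono_le (huv Z hZ)
  have hzero : Tendsto (fun Z : ℝ => C * (0 + 1 / Z + 0)) atTop (nhds 0) := by
    have := (tendsto_inv_atTop_zero (𝕜 := ℝ)).const_mul C
    simpa using this
  refine squeeze_zero' ?_ ?_ hzero
  · filter_upwards [eventually_gt_atTop 0] with Z hZ using hge Z hZ
  · filter_upwards [eventually_gt_atTop 0] with Z hZ using hle Z hZ
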